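/- There is an absolute constant C > 0 such that the following holds. Consider RLS on the uniform-profit instance of the chance-constrained knapsack problem with correlated uniform weights, for any K, m ≥ 1 (n = K·m), any a, d, c > 0, B > 0 and 0 < α < 1. For every initial solution x₀ ∈ {0,1}^n, the expected number of iterations until the current solution is, for the first time, a feasible solution of maximal profit among all feasible solutions is at most C·n³. -/

import Mathlib

open Finset
open scoped ENNReal

noncomputable section

/-- Number of one-bits (selected items) of a solution. -/
def numOnes (K m : ℕ) (x : Fin K → Fin m → Bool) : ℕ :=
  ∑ i, ∑ j, if x i j then 1 else 0

/-- Covariance contribution `2c·Σᵢ Σ_{j1<j2} x_{ij1}·x_{ij2}` of a solution. -/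
def cova (K m : ℕ) (c : ℝ) (x : Fin K → Fin m → Bool) : ℝ :=
  2 * c * ∑ i, ∑ p ∈ Finset.univ.filter (fun p : Fin m × Fin m => p.1 < p.2),
      (if x i p.1 then (1 : ℝ) else 0) * (if x i p.2 then (1 : ℝ) else 0)

/-- Expected weight `E[W(x)] = a·|x|₁`. -/
def expWeight (K m : ℕ) (a : ℝ) (x : Fin K → Fin m → Bool) : ℝ :=
  a * (numOnes K m x : ℝ)

/-- Variance `Var[W(x)] = d·|x|₁ + 2c·Σᵢ Σ_{j1<j2} x_{ij1}·x_{ij2}`. -/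
def varWeight (K m : ℕ) (d c : ℝ) (x : Fin K → Fin m → Bool) : ℝ :=
  d * (numOnes K m x : ℝ) + cova K m c x

/-- Chebyshev surrogate `β(x) = Var[W(x)] / (Var[W(x)] + (B − E[W(x)])²)`. -/
def chebBeta (K m : ℕ) (a d c B : ℝ) (x : Fin K → Fin m → Bool) : ℝ :=
  varWeight K m d c x / (varWeight K m d c x + (B - expWeight K m a x) ^ 2)

/-- A solution is feasible if `E[W(x)] < B` and `β(x) ≤ α`. -/
def feasible (K m : ℕ) (a d c B α : ℝ) (x : Fin K → Fin m → Bool) : Prop :=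
  expWeight K m a x < B ∧ chebBeta K m a d c B x ≤ α

/-- `β'(x) = β(x)` if `E[W(x)] < B`, and `β'(x) = 1 + E[W(x)] − B` otherwise. -/
def betaPrime (K m : ℕ) (a d c B : ℝ) (x : Fin K → Fin m → Bool) : ℝ :=
  if expWeight K m a x < B then chebBeta K m a d c B x else 1 + expWeight K m a x - B

/-- Total profit `p(x) = Σᵢⱼ p_{ij}·x_{ij}`. -/
def profitOf (K m : ℕ) (profit : Fin K → Fin m → ℝ) (x : Fin K → Fin m → Bool) : ℝ :=
  ∑ i, ∑ j, if x i j then profit i j else 0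

/-- `p'(x) = −1` if `β'(x) > α`, and `p'(x) = p(x)` otherwise. -/
def pPrime (K m : ℕ) (a d c B α : ℝ) (profit : Fin K → Fin m → ℝ)
    (x : Fin K → Fin m → Bool) : ℝ :=
  if α < betaPrime K m a d c B x then -1 else profitOf K m profit x

/-- Lexicographic fitness dominance: `f(y) ⪰ f(x)` iff `p'(y) > p'(x)`, or
`p'(y) = p'(x)` and `β'(y) ≤ β'(x)`. -/
def fge (K m : ℕ) (a d c B α : ℝ) (profit : Fin K → Fin m → ℝ)
    (y x : Fin K → Fin m → Bool) : Prop :=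
  pPrime K m a d c B α profit x < pPrime K m a d c B α profit y ∨
    (pPrime K m a d c B α profit y = pPrime K m a d c B α profit x ∧
      betaPrime K m a d c B y ≤ betaPrime K m a d c B x)

/-- Hamming distance between two solutions. -/
def hdist (K m : ℕ) (x y : Fin K → Fin m → Bool) : ℕ :=
  ∑ i, ∑ j, if x i j = y i j then 0 else 1

/-- Standard-bit mutation of the (1+1) EA: each bit flips independently with
probability `1/n`, so `y` is produced from `x` with probability
`(1/n)^{H(x,y)}·(1 − 1/n)^{n − H(x,y)}`. -/
def mutEA (K m : ℕ) (x y : Fin K → Fin m → Bool) : ℝ≥0∞ :=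
  (1 / (K * m : ℝ≥0∞)) ^ hdist K m x y *
    (1 - 1 / (K * m : ℝ≥0∞)) ^ (K * m - hdist K m x y)

/-- RLS mutation: with probability `1/2` flip one uniformly random bit, with probability
`1/2` flip a uniformly random pair of distinct bits; so a one-bit-flip neighbour is
produced with probability `1/(2n)` and a two-bit-flip neighbour with probability
`1/(n(n−1))`. -/
def mutRLS (K m : ℕ) (x y : Fin K → Fin m → Bool) : ℝ≥0∞ :=
  if hdist K m x y = 1 then 1 / (2 * (K * m : ℝ≥0∞))
  else if hdist K m x y = 2 then 1 / ((K * m : ℝ≥0∞) * ((K * m : ℝ≥0∞) - 1))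
  else 0

open scoped Classical in
/-- One-step transition probability of an elitist algorithm with mutation distribution
`mutD` and acceptance relation `acc y x` (= "`f(y) ⪰ f(x)`"): the offspring is accepted
iff `acc`, otherwise the algorithm stays at `x`. -/
def stepP (K m : ℕ)
    (mutD : (Fin K → Fin m → Bool) → (Fin K → Fin m → Bool) → ℝ≥0∞)
    (acc : (Fin K → Fin m → Bool) → (Fin K → Fin m → Bool) → Prop)
    (x y : Fin K → Fin m → Bool) : ℝ≥0∞ :=
  (if acc y x then mutD x y else 0) +
    (if y = x then ∑ z, (if acc z x then 0 else mutD x z) else 0)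

open scoped Classical in
/-- `hitVec K m P A x₀ t y` is the probability that the Markov chain with transition
matrix `P` started at `x₀` has not visited the target set `A` during the first `t` steps
and is currently at `y`. -/
def hitVec (K m : ℕ)
    (P : (Fin K → Fin m → Bool) → (Fin K → Fin m → Bool) → ℝ≥0∞)
    (A : (Fin K → Fin m → Bool) → Prop) (x₀ : Fin K → Fin m → Bool) :
    ℕ → (Fin K → Fin m → Bool) → ℝ≥0∞
  | 0 => fun y => if y = x₀ ∧ ¬ A y then 1 else 0
  | (t + 1) => fun y => if A y then 0 else ∑ x, hitVec K m P A x₀ t x * P x y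

/-- Expected hitting time `E[min {t : X_t ∈ A}]` of the target set `A` for the Markov
chain with transition matrix `P` started at `x₀`, computed as `Σ_{t≥0} Pr(T > t)`. -/
def expHitTime (K m : ℕ)
    (P : (Fin K → Fin m → Bool) → (Fin K → Fin m → Bool) → ℝ≥0∞)
    (A : (Fin K → Fin m → Bool) → Prop) (x₀ : Fin K → Fin m → Bool) : ℝ≥0∞ :=
  ∑' t : ℕ, ∑ y, hitVec K m P A x₀ t y

/-- Covariance `s_ℓ^b` of a balanced solution with `ℓ` one-bits: with `q = ⌊ℓ/K⌋` and
`t = ℓ − qK`, it is `c·[(K − t)·q(q − 1) + t·(q + 1)q]`. -/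
def balCov (K : ℕ) (c : ℝ) (ℓ : ℕ) : ℝ :=
  c * (((K - (ℓ - (ℓ / K) * K)) * ((ℓ / K) * (ℓ / K - 1)) +
        (ℓ - (ℓ / K) * K) * ((ℓ / K + 1) * (ℓ / K)) : ℕ) : ℝ)

/-- The solution obtained from `y` by setting bit `(i, j)` to one. -/
def flipUp (K m : ℕ) (y : Fin K → Fin m → Bool) (i : Fin K) (j : Fin m) :
    Fin K → Fin m → Bool :=
  fun i' j' => if i' = i ∧ j' = j then true else y i' j'

end
section helpers

def gs (K m : ℕ) (x : Fin K → Fin m → Bool) (i : Fin K) : ℕ := ∑ j, if x i j then 1 else 0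

def hr (m : ℕ) (u v : Fin m → Bool) : ℕ := ∑ j, if u j = v j then 0 else 1

lemma numOnes_eq (K m : ℕ) (x : Fin K → Fin m → Bool) : numOnes K m x = ∑ i, gs K m x i := rfl

lemma hdist_eq (K m : ℕ) (x y : Fin K → Fin m → Bool) :
    hdist K m x y = ∑ i, hr m (x i) (y i) := rfl

lemma gs_le (K m : ℕ) (x : Fin K → Fin m → Bool) (i : Fin K) : gs K m x i ≤ m := by
  unfold gs
  calc _ ≤ ∑ j : Fin m, 1 := Finset.sum_le_sum (fun j _ => by split_ifs <;> omega)
    _ = m := by simp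

lemma numOnes_le (K m : ℕ) (x : Fin K → Fin m → Bool) : numOnes K m x ≤ K * m := by
  rw [numOnes_eq]
  calc _ ≤ ∑ i : Fin K, m := Finset.sum_le_sum (fun i _ => gs_le K m x i)
    _ = K * m := by simp

lemma gs_le_add (K m : ℕ) (x y : Fin K → Fin m → Bool) (i : Fin K) :
    gs K m y i ≤ gs K m x i + hr m (x i) (y i) := by
  unfold gs hr
  rw [← Finset.sum_add_distrib]
  refine Finset.sum_le_sum (fun j _ => ?_)
  cases x i j <;> cases y i j <;> simp

lemma gs_le_add2 (K m : ℕ) (x y : Fin K → Fin m → Bool) (i : Fin K) :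
    gs K m x i ≤ gs K m y i + hr m (x i) (y i) := by
  unfold gs hr
  rw [← Finset.sum_add_distrib]
  refine Finset.sum_le_sum (fun j _ => ?_)
  cases x i j <;> cases y i j <;> simp

lemma pair_sum {m : ℕ} (b : Fin m → ℝ) (hb : ∀ j, b j * b j = b j) :
    2 * ∑ p ∈ Finset.univ.filter (fun p : Fin m × Fin m => p.1 < p.2), b p.1 * b p.2
      = (∑ j, b j) ^ 2 - ∑ j, b j := by
  have h1 : (∑ j, b j) ^ 2 = ∑ p : Fin m × Fin m, b p.1 * b p.2 := by
    rw [sq, Finset.sum_mul_sum, Fintype.sum_prod_type]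
  have h2 : ∀ p : Fin m × Fin m, b p.1 * b p.2 =
      (if p.1 < p.2 then b p.1 * b p.2 else 0) + (if p.2 < p.1 then b p.1 * b p.2 else 0)
        + (if p.1 = p.2 then b p.1 * b p.2 else 0) := by
    intro p
    rcases lt_trichotomy p.1 p.2 with h | h | h
    · simp [h, h.ne, h.not_gt]
    · simp [h]
    · simp [h, h.ne', h.not_gt]
  have h3 : ∑ p : Fin m × Fin m, (if p.2 < p.1 then b p.1 * b p.2 else 0)
      = ∑ p : Fin m × Fin m, (if p.1 < p.2 then b p.1 * b p.2 else 0) := by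
    rw [← Equiv.sum_comp (Equiv.prodComm (Fin m) (Fin m))]
    refine Finset.sum_congr rfl (fun p _ => ?_)
    simp [mul_comm]
  have h4 : ∑ p : Fin m × Fin m, (if p.1 = p.2 then b p.1 * b p.2 else 0) = ∑ j, b j := by
    rw [Fintype.sum_prod_type]
    simp [hb]
  rw [Finset.sum_filter, h1, Finset.sum_congr rfl (fun p _ => h2 p), Finset.sum_add_distrib,
    Finset.sum_add_distrib, h3, h4]
  ring

def SS (K m : ℕ) (x : Fin K → Fin m → Bool) : ℕ := ∑ i, gs K m x i ^ 2

lemma varWeight_eq (K m : ℕ) (d c : ℝ) (x : Fin K → Fin m → Bool) :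
    varWeight K m d c x = d * (numOnes K m x : ℝ) + c * ((SS K m x : ℝ) - numOnes K m x) := by
  unfold varWeight cova
  have h : ∀ i, 2 * ∑ p ∈ Finset.univ.filter (fun p : Fin m × Fin m => p.1 < p.2),
      (if x i p.1 then (1 : ℝ) else 0) * (if x i p.2 then (1 : ℝ) else 0)
      = (gs K m x i : ℝ) ^ 2 - gs K m x i := by
    intro i
    have := pair_sum (fun j => if x i j then (1 : ℝ) else 0) (by intro j; simp)
    rw [this]
    simp [gs]
  rw [mul_comm 2 c, mul_assoc, Finset.mul_sum, Finset.sum_congr rfl (fun i _ => h i),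
    Finset.sum_sub_distrib]
  simp [SS, numOnes_eq]

lemma le_sq_nat (k : ℕ) : k ≤ k ^ 2 := by nlinarith [Nat.zero_le k, sq_nonneg ((k:ℤ)), Nat.le_self_pow (n := 2) (by norm_num) k]

lemma numOnes_le_SS (K m : ℕ) (x : Fin K → Fin m → Bool) : numOnes K m x ≤ SS K m x :=
  Finset.sum_le_sum (fun i _ => le_sq_nat _)

lemma var_nonneg (K m : ℕ) (d c : ℝ) (hd : 0 < d) (hc : 0 < c) (x : Fin K → Fin m → Bool) :
    0 ≤ varWeight K m d c x := by
  rw [varWeight_eq]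
  have : (numOnes K m x : ℝ) ≤ SS K m x := by exact_mod_cast numOnes_le_SS K m x
  have := mul_nonneg hc.le (sub_nonneg.2 this)
  positivity

/-- monotonicity of v/(v+r) -/
lemma frac_le {v w r s : ℝ} (hv : 0 ≤ v) (hvw : v ≤ w) (hs : 0 < s) (hsr : s ≤ r) :
    v / (v + r) ≤ w / (w + s) := by
  rw [div_le_div_iff₀ (by linarith) (by linarith)]
  nlinarith [mul_le_mul hvw hsr hs.le (hv.trans hvw)]

lemma frac_lt {v w r s : ℝ} (hv : 0 ≤ v) (hvw : v < w) (hs : 0 < s) (hsr : s ≤ r) :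
    v / (v + r) < w / (w + s) := by
  rw [div_lt_div_iff₀ (by linarith) (by linarith)]
  nlinarith [mul_lt_mul hvw hsr hs (hv.trans hvw.le)]

lemma frac_lt_one {v r : ℝ} (hv : 0 ≤ v) (hr : 0 < r) : v / (v + r) < 1 := by
  rw [div_lt_one (by linarith)]; linarith

section fitness
variable (K m : ℕ) (a d c B α : ℝ)

lemma feas_iff (hα : α < 1) (x : Fin K → Fin m → Bool) :
    feasible K m a d c B α x ↔ ¬ α < betaPrime K m a d c B x := by
  unfold feasible betaPrime
  split_ifs with h
  · simp [h]
  · simp only [h, false_and, false_iff, not_not]; linarith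

/-- fewer ones, smaller variance: smaller betaPrime -/
lemma beta_mono (ha : 0 < a) (hd : 0 < d) (hc : 0 < c) (x y : Fin K → Fin m → Bool)
    (h1 : numOnes K m x ≤ numOnes K m y) (h2 : SS K m x + numOnes K m y ≤ SS K m y + numOnes K m x) :
    betaPrime K m a d c B x ≤ betaPrime K m a d c B y := by
  have e1 : (numOnes K m x : ℝ) ≤ numOnes K m y := by exact_mod_cast h1
  have e2 : (SS K m x : ℝ) + numOnes K m y ≤ SS K m y + numOnes K m x := by exact_mod_cast h2
  have hE : expWeight K m a x ≤ expWeight K m a y := mul_le_mul_of_nonneg_left e1 ha.le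
  have hV : varWeight K m d c x ≤ varWeight K m d c y := by
    rw [varWeight_eq, varWeight_eq]
    have := mul_le_mul_of_nonneg_left e1 hd.le
    have := mul_le_mul_of_nonneg_left
      (show (SS K m x : ℝ) - numOnes K m x ≤ SS K m y - numOnes K m y by linarith) hc.le
    linarith
  have hv := var_nonneg K m d c hd hc x
  unfold betaPrime chebBeta
  split_ifs with p q q
  · exact frac_le hv hV (pow_pos (by linarith) 2) (pow_le_pow_left₀ (by linarith) (by linarith) 2)
  · have := frac_lt_one hv (pow_pos (sub_pos.2 p) 2)
    linarith
  · exact absurd (lt_of_le_of_lt hE q) p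
  · linarith

lemma beta_strict (ha : 0 < a) (hd : 0 < d) (hc : 0 < c) (x y : Fin K → Fin m → Bool)
    (h1 : numOnes K m x < numOnes K m y) (h2 : SS K m x + numOnes K m y ≤ SS K m y + numOnes K m x) :
    betaPrime K m a d c B x < betaPrime K m a d c B y := by
  have e1 : (numOnes K m x : ℝ) < numOnes K m y := by exact_mod_cast h1
  have e2 : (SS K m x : ℝ) + numOnes K m y ≤ SS K m y + numOnes K m x := by exact_mod_cast h2
  have hE : expWeight K m a x < expWeight K m a y := mul_lt_mul_of_pos_left e1 ha
  have hV : varWeight K m d c x < varWeight K m d c y := by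
    rw [varWeight_eq, varWeight_eq]
    have := mul_lt_mul_of_pos_left e1 hd
    have := mul_le_mul_of_nonneg_left
      (show (SS K m x : ℝ) - numOnes K m x ≤ SS K m y - numOnes K m y by linarith) hc.le
    linarith
  have hv := var_nonneg K m d c hd hc x
  unfold betaPrime chebBeta
  split_ifs with p q q
  · exact frac_lt hv hV (pow_pos (by linarith) 2) (pow_le_pow_left₀ (by linarith) (by linarith) 2)
  · have := frac_lt_one hv (pow_pos (sub_pos.2 p) 2)
    linarith
  · exact absurd (lt_of_le_of_lt hE.le q) p
  · linarith

/-- equal ones, feasible -/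
lemma beta_eq (hd : 0 < d) (hc : 0 < c) (x y : Fin K → Fin m → Bool)
    (hx : expWeight K m a x < B)
    (h1 : numOnes K m x = numOnes K m y)
    (hb : betaPrime K m a d c B y ≤ betaPrime K m a d c B x) : SS K m y ≤ SS K m x := by
  by_contra! h
  have hE : expWeight K m a x = expWeight K m a y := by unfold expWeight; rw [h1]
  have e2 : (SS K m x : ℝ) < SS K m y := by exact_mod_cast h
  have hV : varWeight K m d c x < varWeight K m d c y := by
    rw [varWeight_eq, varWeight_eq, h1]
    have := mul_lt_mul_of_pos_left e2 hc
    linarith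
  have hv := var_nonneg K m d c hd hc x
  unfold betaPrime chebBeta at hb
  rw [← hE, if_pos hx, if_pos hx] at hb
  exact absurd hb (not_le.2 (frac_lt hv hV (pow_pos (by linarith) 2) le_rfl))

lemma profit_one (x : Fin K → Fin m → Bool) :
    profitOf K m (fun _ _ => 1) x = numOnes K m x := by
  simp [profitOf, numOnes]

lemma pPrime_feas (hα : α < 1) (x : Fin K → Fin m → Bool) (h : feasible K m a d c B α x) :
    pPrime K m a d c B α (fun _ _ => 1) x = numOnes K m x := by
  unfold pPrime
  rw [if_neg ((feas_iff K m a d c B α hα x).1 h), profit_one]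

lemma pPrime_infeas (hα : α < 1) (x : Fin K → Fin m → Bool) (h : ¬ feasible K m a d c B α x) :
    pPrime K m a d c B α (fun _ _ => 1) x = -1 := by
  unfold pPrime
  rw [if_pos]
  by_contra h2
  exact h ((feas_iff K m a d c B α hα x).2 h2)

lemma feas_zero (hB : 0 < B) (hα : 0 < α) (x : Fin K → Fin m → Bool)
    (h : numOnes K m x = 0) : feasible K m a d c B α x := by
  have hS : SS K m x = 0 := by
    unfold SS
    rw [numOnes_eq] at h
    refine Finset.sum_eq_zero (fun i hi => ?_)
    rw [Finset.sum_eq_zero_iff.1 h i hi]; rfl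
  unfold feasible chebBeta
  rw [varWeight_eq]
  simp [h, hS, expWeight, hB, hα.le]

lemma feas_mono (ha : 0 < a) (hd : 0 < d) (hc : 0 < c) (hα : α < 1) (x y : Fin K → Fin m → Bool)
    (h1 : numOnes K m x ≤ numOnes K m y) (h2 : SS K m x + numOnes K m y ≤ SS K m y + numOnes K m x)
    (hy : feasible K m a d c B α y) : feasible K m a d c B α x := by
  rw [feas_iff K m a d c B α hα] at hy ⊢
  have := beta_mono K m a d c B ha hd hc x y h1 h2
  linarith

end fitness

lemma two_change {ι : Type*} [Fintype ι] [DecidableEq ι] (k k2 : ι → ℕ) (i j : ι) (hij : i ≠ j)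
    (h : ∀ l, l ≠ i → l ≠ j → k2 l = k l) (f : ℕ → ℕ) :
    ∑ l, f (k2 l) + f (k i) + f (k j) = ∑ l, f (k l) + f (k2 i) + f (k2 j) := by
  have e : ∀ g : ι → ℕ, ∑ l, g l = g i + (g j + ∑ l ∈ (Finset.univ.erase i).erase j, g l) := by
    intro g
    rw [Finset.add_sum_erase _ g (by simp [hij.symm]), Finset.add_sum_erase _ g (Finset.mem_univ i)]
  have : ∑ l ∈ (Finset.univ.erase i).erase j, f (k2 l) = ∑ l ∈ (Finset.univ.erase i).erase j, f (k l) := by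
    refine Finset.sum_congr rfl (fun l hl => ?_)
    simp only [Finset.mem_erase, Finset.mem_univ, and_true] at hl
    rw [h l hl.2 hl.1]
  rw [e (fun l => f (k2 l)), e (fun l => f (k l)), this]
  ring

lemma one_change {ι : Type*} [Fintype ι] [DecidableEq ι] (k k2 : ι → ℕ) (i : ι)
    (h : ∀ l, l ≠ i → k2 l = k l) (f : ℕ → ℕ) :
    ∑ l, f (k2 l) + f (k i) = ∑ l, f (k l) + f (k2 i) := by
  have : ∑ l ∈ (Finset.univ.erase i), f (k2 l) = ∑ l ∈ (Finset.univ.erase i), f (k l) := by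
    refine Finset.sum_congr rfl (fun l hl => ?_)
    simp only [Finset.mem_erase, Finset.mem_univ, and_true] at hl
    rw [h l hl]
  rw [← Finset.add_sum_erase _ (fun l => f (k2 l)) (Finset.mem_univ i),
    ← Finset.add_sum_erase _ (fun l => f (k l)) (Finset.mem_univ i), this]
  ring

lemma up_all {ι : Type*} [Fintype ι] [DecidableEq ι] (k k2 h : ι → ℕ) (hh : ∑ i, h i ≤ 2)
    (h1 : ∀ i, k2 i ≤ k i + h i) (h2 : ∀ i, k i ≤ k2 i + h i) (hlt : ∑ i, k i < ∑ i, k2 i) :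
    ∀ i, k i ≤ k2 i := by
  intro i
  by_contra! hi
  have e : ∑ l ∈ Finset.univ.erase i, k2 l ≤
      ∑ l ∈ Finset.univ.erase i, k l + ∑ l ∈ Finset.univ.erase i, h l := by
    rw [← Finset.sum_add_distrib]; exact Finset.sum_le_sum (fun l _ => h1 l)
  rw [← Finset.add_sum_erase _ _ (Finset.mem_univ i)] at hh
  rw [← Finset.add_sum_erase _ k (Finset.mem_univ i),
    ← Finset.add_sum_erase _ k2 (Finset.mem_univ i)] at hlt
  have := h2 i
  omega

lemma same_sum {ι : Type*} [Fintype ι] [DecidableEq ι] (k k2 h : ι → ℕ) (hh : ∑ i, h i ≤ 2)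
    (h1 : ∀ i, k2 i ≤ k i + h i) (h2 : ∀ i, k i ≤ k2 i + h i) (he : ∑ i, k i = ∑ i, k2 i)
    (hne : k ≠ k2) :
    ∃ i j, i ≠ j ∧ k2 i + 1 = k i ∧ k2 j = k j + 1 ∧ ∀ l, l ≠ i → l ≠ j → k2 l = k l := by
  have hi : ∃ i, k2 i < k i := by
    by_contra! hc
    exact hne (funext fun i => (Finset.sum_eq_sum_iff_of_le (fun i _ => hc i)).1 he i (Finset.mem_univ i))
  have hj : ∃ i, k i < k2 i := by
    by_contra! hc
    exact hne (funext fun i =>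
      ((Finset.sum_eq_sum_iff_of_le (fun i _ => hc i)).1 he.symm i (Finset.mem_univ i)).symm)
  obtain ⟨i, hi⟩ := hi
  obtain ⟨j, hj⟩ := hj
  have hij : i ≠ j := by rintro rfl; omega
  rw [← Finset.add_sum_erase _ h (Finset.mem_univ i),
    ← Finset.add_sum_erase _ h (show j ∈ Finset.univ.erase i by simp [hij.symm])] at hh
  have a1 := h1 i
  have a2 := h2 i
  have a3 := h1 j
  have a4 := h2 j
  refine ⟨i, j, hij, by omega, by omega, fun l l1 l2 => ?_⟩
  have := Finset.single_le_sum (f := h) (s := (Finset.univ.erase i).erase j) (fun _ _ => Nat.zero_le _)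
    (show l ∈ (Finset.univ.erase i).erase j by simp [l1, l2])
  have a5 := h1 l
  have a6 := h2 l
  omega

def gq (q k : ℕ) : ℕ := (k - q) + (k - q - 1)

def Phi (K m : ℕ) (x : Fin K → Fin m → Bool) : ℕ := ∑ i, gq (numOnes K m x / K) (gs K m x i)

lemma Phi_le (K m : ℕ) (x : Fin K → Fin m → Bool) : Phi K m x ≤ 2 * numOnes K m x := by
  rw [numOnes_eq, Finset.mul_sum]
  exact Finset.sum_le_sum (fun i _ => by
    unfold gq
    generalize numOnes K m x / K = q
    omega)

open scoped Classical in
noncomputable def VV (K m : ℕ) (a d c B α : ℝ) (x : Fin K → Fin m → Bool) : ℕ :=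
  if feasible K m a d c B α x then 5 * (K * m - numOnes K m x) + Phi K m x
  else 5 * (K * m) + numOnes K m x + 1

lemma VV_feas_le (K m : ℕ) (a d c B α : ℝ) (x : Fin K → Fin m → Bool)
    (h : feasible K m a d c B α x) : VV K m a d c B α x ≤ 5 * (K * m) := by
  have := Phi_le K m x
  have := numOnes_le K m x
  unfold VV; rw [if_pos h]; omega

lemma VV_le (K m : ℕ) (hK : 1 ≤ K) (hm : 1 ≤ m) (a d c B α : ℝ) (x : Fin K → Fin m → Bool) :
    VV K m a d c B α x ≤ 7 * (K * m) := by
  have := numOnes_le K m x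
  have : 0 < K * m := Nat.mul_pos hK hm
  by_cases h : feasible K m a d c B α x
  · have := VV_feas_le K m a d c B α x h; omega
  · unfold VV; rw [if_neg h]; omega

lemma SS_up (K m : ℕ) (x y : Fin K → Fin m → Bool) (h : ∀ i, gs K m x i ≤ gs K m y i) :
    SS K m x + numOnes K m y ≤ SS K m y + numOnes K m x := by
  rw [numOnes_eq, numOnes_eq]
  unfold SS
  rw [← Finset.sum_add_distrib, ← Finset.sum_add_distrib]
  refine Finset.sum_le_sum (fun i _ => ?_)
  obtain ⟨e, he⟩ := Nat.exists_eq_add_of_le (h i)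
  rw [he]
  nlinarith [le_sq_nat e, Nat.zero_le (gs K m x i * e)]

section mono
variable (K m : ℕ) (a d c B α : ℝ)

lemma VV_mono (ha : 0 < a) (hd : 0 < d) (hc : 0 < c) (hα : α < 1) (x y : Fin K → Fin m → Bool)
    (hh : hdist K m x y ≤ 2) (hacc : fge K m a d c B α (fun _ _ => 1) y x) :
    VV K m a d c B α y ≤ VV K m a d c B α x := by
  rw [hdist_eq] at hh
  have g1 := gs_le_add K m x y
  have g2 := gs_le_add2 K m x y
  by_cases hx : feasible K m a d c B α x
  · have px := pPrime_feas K m a d c B α hα x hx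
    unfold fge at hacc
    have hy : feasible K m a d c B α y := by
      by_contra hy
      rw [px, pPrime_infeas K m a d c B α hα y hy] at hacc
      have : (0:ℝ) ≤ numOnes K m x := Nat.cast_nonneg _
      rcases hacc with h | h
      · linarith
      · linarith [h.1]
    rw [px, pPrime_feas K m a d c B α hα y hy] at hacc
    unfold VV
    rw [if_pos hx, if_pos hy]
    rcases hacc with h | ⟨h, hb⟩
    · have hlt : numOnes K m x < numOnes K m y := by exact_mod_cast h
      have hq : numOnes K m x / K ≤ numOnes K m y / K := Nat.div_le_div_right hlt.le
      have : Phi K m y ≤ Phi K m x + 2 * ∑ i, hr m (x i) (y i) := by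
        unfold Phi
        rw [Finset.mul_sum, ← Finset.sum_add_distrib]
        refine Finset.sum_le_sum (fun i _ => ?_)
        have := g1 i
        unfold gq; omega
      have := numOnes_le K m y
      omega
    · have he : numOnes K m y = numOnes K m x := by exact_mod_cast h
      rw [he]
      have hS := beta_eq K m a d c B hd hc x y hx.1 he.symm hb
      refine Nat.add_le_add_left ?_ _
      unfold Phi
      rw [he]
      by_cases hk : gs K m x = gs K m y
      · rw [hk]
      · obtain ⟨i, j, hij, k1, k2, k3⟩ := same_sum (gs K m x) (gs K m y) _ hh g1 g2 he.symm hk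
        have e1 := two_change _ _ i j hij k3 (fun k => k ^ 2)
        have e2 := two_change _ _ i j hij k3 (gq (numOnes K m x / K))
        unfold SS at hS
        have : gs K m x j + 1 ≤ gs K m x i := by
          simp only [k2] at e1
          rw [← k1] at e1 ⊢
          nlinarith
        rw [k2] at e2
        unfold gq at e2 ⊢
        omega
  · by_cases hy : feasible K m a d c B α y
    · have := VV_feas_le K m a d c B α y hy
      refine this.trans ?_
      unfold VV; rw [if_neg hx]; omega
    · unfold VV
      rw [if_neg hx, if_neg hy]
      unfold fge at hacc
      rw [pPrime_infeas K m a d c B α hα x hx, pPrime_infeas K m a d c B α hα y hy] at hacc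
      have hb : betaPrime K m a d c B y ≤ betaPrime K m a d c B x := by
        rcases hacc with h | h
        · exact absurd h (lt_irrefl _)
        · exact h.2
      have : numOnes K m y ≤ numOnes K m x := by
        by_contra! hlt
        have hall := up_all (gs K m x) (gs K m y) _ hh g1 g2 hlt
        have := beta_strict K m a d c B ha hd hc x y hlt (SS_up K m x y hall)
        linarith
      omega

end mono

lemma row_down {m : ℕ} (u : Fin m → Bool) (h : 0 < ∑ j, if u j then 1 else 0) :
    ∃ v : Fin m → Bool, hr m u v = 1 ∧
      (∑ j, if v j then 1 else 0) + 1 = ∑ j, if u j then 1 else 0 := by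
  have : ∃ j, u j = true := by
    by_contra! hc
    simp [hc] at h
  obtain ⟨j, hj⟩ := this
  refine ⟨Function.update u j false, ?_, ?_⟩
  · unfold hr
    rw [Finset.sum_eq_single j]
    · simp [hj]
    · intro b _ hb; simp [hb]
    · simp
  · rw [← Finset.add_sum_erase _ _ (Finset.mem_univ j),
      ← Finset.add_sum_erase _ (fun j => if u j = true then 1 else 0) (Finset.mem_univ j)]
    have : ∑ l ∈ Finset.univ.erase j, (if Function.update u j false l = true then 1 else 0)
        = ∑ l ∈ Finset.univ.erase j, (if u l = true then 1 else 0) := by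
      refine Finset.sum_congr rfl (fun l hl => ?_)
      rw [Function.update_of_ne (Finset.ne_of_mem_erase hl)]
    rw [this]
    simp [hj, add_comm]

lemma row_up {m : ℕ} (u : Fin m → Bool) (h : (∑ j, if u j then 1 else 0) < m) :
    ∃ v : Fin m → Bool, hr m u v = 1 ∧
      (∑ j, if v j then 1 else 0) = (∑ j, if u j then 1 else 0) + 1 := by
  have : ∃ j, u j = false := by
    by_contra! hc
    simp [hc] at h
  obtain ⟨j, hj⟩ := this
  refine ⟨Function.update u j true, ?_, ?_⟩
  · unfold hr
    rw [Finset.sum_eq_single j]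
    · simp [hj]
    · intro b _ hb; simp [hb]
    · simp
  · rw [← Finset.add_sum_erase _ _ (Finset.mem_univ j),
      ← Finset.add_sum_erase _ (fun j => if u j = true then 1 else 0) (Finset.mem_univ j)]
    have : ∑ l ∈ Finset.univ.erase j, (if Function.update u j true l = true then 1 else 0)
        = ∑ l ∈ Finset.univ.erase j, (if u l = true then 1 else 0) := by
      refine Finset.sum_congr rfl (fun l hl => ?_)
      rw [Function.update_of_ne (Finset.ne_of_mem_erase hl)]
    rw [this]
    simp [hj, add_comm]

lemma hr_self {m : ℕ} (u : Fin m → Bool) : hr m u u = 0 := by simp [hr]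

lemma mk_down (K m : ℕ) (x : Fin K → Fin m → Bool) (i : Fin K) (h : 0 < gs K m x i) :
    ∃ y, hdist K m x y = 1 ∧ gs K m y i + 1 = gs K m x i ∧ ∀ l, l ≠ i → gs K m y l = gs K m x l := by
  obtain ⟨v, h1, h2⟩ := row_down (x i) h
  refine ⟨Function.update x i v, ?_, ?_, ?_⟩
  · rw [hdist_eq, Finset.sum_eq_single i]
    · simpa using h1
    · intro b _ hb; simp [hb, hr_self]
    · simp
  · unfold gs; simpa using h2
  · intro l hl; unfold gs; rw [Function.update_of_ne hl]

lemma mk_up (K m : ℕ) (x : Fin K → Fin m → Bool) (i : Fin K) (h : gs K m x i < m) :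
    ∃ y, hdist K m x y = 1 ∧ gs K m y i = gs K m x i + 1 ∧ ∀ l, l ≠ i → gs K m y l = gs K m x l := by
  obtain ⟨v, h1, h2⟩ := row_up (x i) h
  refine ⟨Function.update x i v, ?_, ?_, ?_⟩
  · rw [hdist_eq, Finset.sum_eq_single i]
    · simpa using h1
    · intro b _ hb; simp [hb, hr_self]
    · simp
  · unfold gs; simpa using h2
  · intro l hl; unfold gs; rw [Function.update_of_ne hl]

lemma mk_swap (K m : ℕ) (x : Fin K → Fin m → Bool) (i j : Fin K) (hij : i ≠ j)
    (hi : 0 < gs K m x i) (hj : gs K m x j < m) :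
    ∃ y, hdist K m x y = 2 ∧ gs K m y i + 1 = gs K m x i ∧ gs K m y j = gs K m x j + 1 ∧
      ∀ l, l ≠ i → l ≠ j → gs K m y l = gs K m x l := by
  obtain ⟨v, h1, h2⟩ := row_down (x i) hi
  obtain ⟨w, h3, h4⟩ := row_up (x j) hj
  refine ⟨Function.update (Function.update x i v) j w, ?_, ?_, ?_, ?_⟩
  · rw [hdist_eq, Finset.sum_eq_add i j hij]
    · simp [hij, h1, h3]
    · intro b _ hb; simp [hb.1, hb.2, hr_self]
    · simp
    · simp
  · unfold gs; simpa [hij] using h2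
  · unfold gs; simpa using h4
  · intro l hl hl2; unfold gs; rw [Function.update_of_ne hl2, Function.update_of_ne hl]

lemma bal_term (q k : ℕ) : (2 * q + 1) * k ≤ k ^ 2 + q * (q + 1) := by
  rcases le_or_gt k q with h | h
  · obtain ⟨e, rfl⟩ := Nat.exists_eq_add_of_le h
    nlinarith [Nat.zero_le (e * e)]
  · obtain ⟨e, rfl⟩ := Nat.exists_eq_add_of_lt h
    nlinarith [Nat.zero_le (e * e)]

lemma SS_lower (K m q : ℕ) (z : Fin K → Fin m → Bool) :
    (2 * q + 1) * numOnes K m z ≤ SS K m z + K * (q * (q + 1)) := by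
  rw [numOnes_eq, Finset.mul_sum]
  have := Finset.sum_le_sum (s := Finset.univ) (fun i _ => bal_term q (gs K m z i))
  rw [Finset.sum_add_distrib] at this
  simpa [SS] using this

lemma SS_bal (K m q : ℕ) (z : Fin K → Fin m → Bool)
    (h : ∀ i, gs K m z i = q ∨ gs K m z i = q + 1) :
    (2 * q + 1) * numOnes K m z = SS K m z + K * (q * (q + 1)) := by
  rw [numOnes_eq, Finset.mul_sum]
  have := Finset.sum_congr (s₁ := Finset.univ) rfl
    (fun i _ => show (2 * q + 1) * gs K m z i = gs K m z i ^ 2 + q * (q + 1) by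
      rcases h i with h | h <;> rw [h] <;> ring)
  rw [Finset.sum_add_distrib] at this
  simpa [SS] using this

section improve
variable (K m : ℕ) (a d c B α : ℝ)

lemma improve (hK : 1 ≤ K) (ha : 0 < a) (hd : 0 < d) (hc : 0 < c) (hB : 0 < B)
    (hα0 : 0 < α) (hα : α < 1) (x : Fin K → Fin m → Bool)
    (hx : ¬ (feasible K m a d c B α x ∧
      ∀ z, feasible K m a d c B α z → numOnes K m z ≤ numOnes K m x)) :
    ∃ y, (hdist K m x y = 1 ∨ hdist K m x y = 2) ∧ fge K m a d c B α (fun _ _ => 1) y x ∧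
      VV K m a d c B α y + 1 ≤ VV K m a d c B α x := by
  by_cases hf : feasible K m a d c B α x
  · have hz : ∃ z, feasible K m a d c B α z ∧ numOnes K m x < numOnes K m z := by
      by_contra! h
      exact hx ⟨hf, h⟩
    obtain ⟨z, hz, hlt⟩ := hz
    obtain ⟨q, hq⟩ : ∃ q, q = numOnes K m x / K := ⟨_, rfl⟩
    have q1 : K * q ≤ numOnes K m x := by rw [hq]; exact Nat.mul_div_le _ _
    have q2 : numOnes K m x < K * (q + 1) := by
      rw [hq]; exact Nat.lt_mul_div_succ _ hK
    have exlow : ∃ j, gs K m x j ≤ q := by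
      by_contra! h
      have : ∑ i : Fin K, (q + 1) ≤ ∑ i, gs K m x i := Finset.sum_le_sum (fun i _ => h i)
      rw [← numOnes_eq] at this
      simp at this
      omega
    by_cases hbal : ∀ i, gs K m x i = q ∨ gs K m x i = q + 1
    · obtain ⟨j, hj⟩ := exlow
      have hjq : gs K m x j = q := by rcases hbal j with h | h <;> omega
      have hqm : q < m := by
        have := numOnes_le K m z
        exact Nat.lt_of_mul_lt_mul_left (show K * q < K * m by omega)
      obtain ⟨y, y1, y2, y3⟩ := mk_up K m x j (by omega)
      have e1 : numOnes K m y = numOnes K m x + 1 := by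
        have := one_change (gs K m x) (gs K m y) j y3 id
        simp only [id] at this
        rw [numOnes_eq, numOnes_eq]
        omega
      have ybal : ∀ i, gs K m y i = q ∨ gs K m y i = q + 1 := by
        intro i
        by_cases h : i = j
        · subst h; right; omega
        · rw [y3 i h]; exact hbal i
      have b1 := SS_bal K m q y ybal
      have b2 := SS_lower K m q z
      have hyz : numOnes K m y ≤ numOnes K m z := by omega
      have fy : feasible K m a d c B α y := by
        refine feas_mono K m a d c B α ha hd hc hα y z hyz ?_ hz
        nlinarith [Nat.mul_le_mul_left q hyz]
      refine ⟨y, Or.inl y1, ?_, ?_⟩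
      · left
        rw [pPrime_feas K m a d c B α hα x hf, pPrime_feas K m a d c B α hα y fy, e1]
        push_cast; linarith
      · unfold VV
        rw [if_pos hf, if_pos fy]
        have hP : Phi K m y ≤ Phi K m x + 2 := by
          have e2 := one_change (gs K m x) (gs K m y) j y3 (gq q)
          have hq2 : numOnes K m x / K ≤ numOnes K m y / K := Nat.div_le_div_right (by omega)
          rw [← hq] at hq2
          have : Phi K m y ≤ ∑ i, gq q (gs K m y i) := by
            unfold Phi
            refine Finset.sum_le_sum (fun i _ => ?_)
            unfold gq; omega
          have e3 : Phi K m x = ∑ i, gq q (gs K m x i) := by unfold Phi; rw [hq]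
          have : gq q (gs K m y j) ≤ gq q (gs K m x j) + 2 := by unfold gq; omega
          omega
        have := numOnes_le K m y
        omega
    · have hsw : ∃ i j, gs K m x j + 2 ≤ gs K m x i ∧
          ((q + 2 ≤ gs K m x i ∧ gs K m x j ≤ q) ∨ (q + 1 ≤ gs K m x i ∧ gs K m x j < q)) := by
        push Not at hbal
        obtain ⟨l, hl1, hl2⟩ := hbal
        by_cases hl : q + 2 ≤ gs K m x l
        · obtain ⟨j, hj⟩ := exlow
          exact ⟨l, j, by omega, by omega⟩
        · have hl3 : gs K m x l < q := by omega
          have : ∃ i, q + 1 ≤ gs K m x i := by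
            by_contra! h
            have : ∑ i, gs K m x i < ∑ i : Fin K, q :=
              Finset.sum_lt_sum (fun i _ => by have := h i; omega) ⟨l, Finset.mem_univ l, hl3⟩
            rw [← numOnes_eq] at this
            simp at this
            omega
          obtain ⟨i, hi⟩ := this
          exact ⟨i, l, by omega, by omega⟩
      obtain ⟨i, j, s1, s2⟩ := hsw
      have hij : i ≠ j := by rintro rfl; omega
      have := gs_le K m x i
      obtain ⟨y, y1, y2, y3, y4⟩ := mk_swap K m x i j hij (by omega) (by omega)
      have e0 : numOnes K m y = numOnes K m x := by
        have := two_change (gs K m x) (gs K m y) i j hij y4 id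
        simp only [id] at this
        rw [numOnes_eq, numOnes_eq]
        omega
      have e1 : SS K m y ≤ SS K m x := by
        have := two_change (gs K m x) (gs K m y) i j hij y4 (fun k => k ^ 2)
        unfold SS
        simp only [y3] at this
        rw [← y2] at this s1
        nlinarith
      have fy := feas_mono K m a d c B α ha hd hc hα y x (by omega) (by omega) hf
      refine ⟨y, Or.inr y1, ?_, ?_⟩
      · right
        rw [pPrime_feas K m a d c B α hα x hf, pPrime_feas K m a d c B α hα y fy, e0]
        exact ⟨rfl, beta_mono K m a d c B ha hd hc y x (by omega) (by omega)⟩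
      · unfold VV
        rw [if_pos hf, if_pos fy, e0]
        have : Phi K m y + 1 ≤ Phi K m x := by
          unfold Phi
          rw [e0, ← hq]
          have := two_change (gs K m x) (gs K m y) i j hij y4 (gq q)
          have : gq q (gs K m y i) + gq q (gs K m y j) + 1 ≤
            gq q (gs K m x i) + gq q (gs K m x j) := by unfold gq; omega
          omega
        omega
  · have hpos : numOnes K m x ≠ 0 := fun h => hf (feas_zero K m a d c B α hB hα0 x h)
    have : ∃ i, 0 < gs K m x i := by
      by_contra! h
      apply hpos
      rw [numOnes_eq]
      exact Finset.sum_eq_zero (fun i _ => by have := h i; omega)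
    obtain ⟨i, hi⟩ := this
    obtain ⟨y, y1, y2, y3⟩ := mk_down K m x i hi
    have e1 : numOnes K m y + 1 = numOnes K m x := by
      have := one_change (gs K m x) (gs K m y) i y3 id
      simp only [id] at this
      rw [numOnes_eq, numOnes_eq]
      omega
    have hall : ∀ l, gs K m y l ≤ gs K m x l := by
      intro l
      by_cases h : l = i
      · subst h; omega
      · rw [y3 l h]
    have hb := beta_strict K m a d c B ha hd hc y x (by omega) (SS_up K m y x hall)
    refine ⟨y, Or.inl y1, ?_, ?_⟩
    · unfold fge
      rw [pPrime_infeas K m a d c B α hα x hf]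
      by_cases fy : feasible K m a d c B α y
      · left
        rw [pPrime_feas K m a d c B α hα y fy]
        have : (0:ℝ) ≤ numOnes K m y := Nat.cast_nonneg _
        linarith
      · right
        exact ⟨pPrime_infeas K m a d c B α hα y fy, hb.le⟩
    · by_cases fy : feasible K m a d c B α y
      · have := VV_feas_le K m a d c B α y fy
        have e : VV K m a d c B α x = 5 * (K * m) + numOnes K m x + 1 := by
          unfold VV; rw [if_neg hf]
        omega
      · unfold VV
        rw [if_neg hf, if_neg fy]
        omega

end improve

section markov

lemma card_hdist (K m h : ℕ) (x : Fin K → Fin m → Bool) :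
    (Finset.univ.filter (fun y => hdist K m x y = h)).card ≤ (K * m).choose h := by
  classical
  have hc : (K * m).choose h
      = (Finset.powersetCard h (Finset.univ : Finset (Fin K × Fin m))).card := by
    simp
  rw [hc]
  refine Finset.card_le_card_of_injOn
    (fun y => Finset.univ.filter (fun p : Fin K × Fin m => x p.1 p.2 ≠ y p.1 p.2)) ?_ ?_
  · intro y hy
    simp only [Finset.coe_filter, Finset.mem_univ, true_and, Set.mem_ofPred_eq] at hy
    simp only [Finset.mem_coe, Finset.mem_powersetCard,
      Finset.subset_univ, true_and, Set.mem_ofPred_eq]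
    rw [← hy, Finset.card_filter, Fintype.sum_prod_type]
    unfold hdist
    refine Finset.sum_congr rfl (fun i _ => Finset.sum_congr rfl (fun j _ => ?_))
    by_cases e : x i j = y i j <;> simp [e]
  · intro y _ z _ hyz
    funext i j
    have := Finset.ext_iff.1 hyz (i, j)
    simp only [Finset.mem_filter, Finset.mem_univ, true_and] at this
    revert this
    cases x i j <;> cases y i j <;> cases z i j <;> simp

lemma mut_sum_le (K m : ℕ) (hK : 1 ≤ K) (hm : 1 ≤ m) (x : Fin K → Fin m → Bool) :
    ∑ y, mutRLS K m x y ≤ 1 := by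
  classical
  have hn : 1 ≤ K * m := Nat.mul_pos hK hm
  have hcast : (K * m : ℝ≥0∞) = ((K * m : ℕ) : ℝ≥0∞) := by push_cast; rfl
  obtain ⟨n, hnn⟩ : ∃ n, n = K * m := ⟨_, rfl⟩
  have hs : ∀ y, mutRLS K m x y =
      (if hdist K m x y = 1 then 1 / (2 * (n : ℝ≥0∞)) else 0) +
      (if hdist K m x y = 2 then 1 / ((n : ℝ≥0∞) * ((n : ℝ≥0∞) - 1)) else 0) := by
    intro y
    unfold mutRLS
    rw [hcast, ← hnn]
    by_cases h1 : hdist K m x y = 1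
    · simp [h1]
    · simp [h1]
  rw [Finset.sum_congr rfl (fun y _ => hs y), Finset.sum_add_distrib, ← Finset.sum_filter,
    ← Finset.sum_filter, Finset.sum_const, Finset.sum_const, nsmul_eq_mul, nsmul_eq_mul]
  have c1 := card_hdist K m 1 x
  have c2 := card_hdist K m 2 x
  rw [← hnn] at c1 c2 hn
  rw [Nat.choose_one_right] at c1
  have k1 : (((Finset.univ.filter (fun y => hdist K m x y = 1)).card : ℕ) : ℝ≥0∞) * (1 / (2 * (n : ℝ≥0∞)))
      ≤ 1 / 2 := by
    refine (mul_le_mul_left (Nat.cast_le.2 c1) _).trans ?_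
    rw [← mul_div_assoc, mul_one, mul_comm 2 (n : ℝ≥0∞)]
    refine ENNReal.div_le_of_le_mul ?_
    rw [mul_comm (n : ℝ≥0∞) 2, ← mul_assoc, ENNReal.div_mul_cancel (by simp) (by simp), one_mul]
  have k2 : (((Finset.univ.filter (fun y => hdist K m x y = 2)).card : ℕ) : ℝ≥0∞)
      * (1 / ((n : ℝ≥0∞) * ((n : ℝ≥0∞) - 1))) ≤ 1 / 2 := by
    refine (mul_le_mul_left (Nat.cast_le.2 c2) _).trans ?_
    rcases Nat.lt_or_ge n 2 with h | h
    · have : n = 1 := by omega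
      subst this
      simp
    · rw [← mul_div_assoc, mul_one]
      refine ENNReal.div_le_of_le_mul ?_
      have hch : n.choose 2 * 2 = n * (n - 1) := by
        rw [Nat.choose_two_right]
        exact Nat.div_mul_cancel (Nat.even_mul_pred_self n).two_dvd
      have hc2 : (n : ℝ≥0∞) * ((n : ℝ≥0∞) - 1) = (n.choose 2 : ℝ≥0∞) * 2 := by
        have : ((n - 1 : ℕ) : ℝ≥0∞) = (n : ℝ≥0∞) - 1 := by
          rw [ENNReal.natCast_sub]; simp
        rw [← this]
        exact_mod_cast hch.symm
      rw [hc2, mul_comm (n.choose 2 : ℝ≥0∞) 2, ← mul_assoc,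
        ENNReal.div_mul_cancel (by simp) (by simp), one_mul]
  calc _ ≤ (1:ℝ≥0∞) / 2 + 1 / 2 := add_le_add k1 k2
    _ = 1 := ENNReal.add_halves 1

lemma mut_ge (K m : ℕ) (hK : 1 ≤ K) (hm : 1 ≤ m) (x y : Fin K → Fin m → Bool)
    (h : hdist K m x y = 1 ∨ hdist K m x y = 2) :
    (2 * ((K * m : ℕ) : ℝ≥0∞) ^ 2)⁻¹ ≤ mutRLS K m x y := by
  have hn : 1 ≤ K * m := Nat.mul_pos hK hm
  have hcast : (K * m : ℝ≥0∞) = ((K * m : ℕ) : ℝ≥0∞) := by push_cast; rfl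
  unfold mutRLS
  rw [hcast]
  generalize K * m = n at *
  have hn1 : (1 : ℝ≥0∞) ≤ n := by exact_mod_cast hn
  rcases h with h | h
  · rw [if_pos h, one_div]
    refine ENNReal.inv_le_inv.2 ?_
    rw [sq]
    gcongr
    exact le_mul_of_one_le_left' hn1
  · rw [if_neg (by omega), if_pos h, one_div]
    refine ENNReal.inv_le_inv.2 ?_
    calc (n : ℝ≥0∞) * (n - 1) ≤ n * n := by gcongr; exact tsub_le_self
      _ = 1 * (n : ℝ≥0∞) ^ 2 := by rw [sq, one_mul]
      _ ≤ _ := by gcongr; norm_num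

lemma drift (K m : ℕ)
    (mutD : (Fin K → Fin m → Bool) → (Fin K → Fin m → Bool) → ℝ≥0∞)
    (acc : (Fin K → Fin m → Bool) → (Fin K → Fin m → Bool) → Prop)
    (V : (Fin K → Fin m → Bool) → ℕ) (x w : Fin K → Fin m → Bool) (ε : ℝ≥0∞)
    (hsum : ∑ y, mutD x y ≤ 1)
    (hmono : ∀ y, mutD x y ≠ 0 → acc y x → V y ≤ V x)
    (hw : acc w x) (hw1 : V w + 1 ≤ V x) (hw2 : ε ≤ mutD x w) :
    ∑ y, stepP K m mutD acc x y * (V y : ℝ≥0∞) + ε ≤ V x := by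
  classical
  have e1 : ∑ y, stepP K m mutD acc x y * (V y : ℝ≥0∞)
      = ∑ y, mutD x y * (if acc y x then (V y : ℝ≥0∞) else V x) := by
    unfold stepP
    simp only [add_mul, Finset.sum_add_distrib, ite_mul, zero_mul, Finset.sum_ite_eq',
      Finset.mem_univ, if_true]
    rw [Finset.sum_mul, ← Finset.sum_add_distrib]
    refine Finset.sum_congr rfl (fun y _ => ?_)
    by_cases h : acc y x <;> simp [h]
  have e2 : ∑ y, mutD x y * (if acc y x then (V y : ℝ≥0∞) else V x) + mutD x w
      ≤ ∑ y, mutD x y * (V x : ℝ≥0∞) := by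
    have : mutD x w = ∑ y, if y = w then mutD x w else 0 := by simp
    rw [this, ← Finset.sum_add_distrib]
    refine Finset.sum_le_sum (fun y _ => ?_)
    by_cases hy : y = w
    · subst hy
      simp only [hw, if_true]
      calc mutD x y * (V y : ℝ≥0∞) + mutD x y = mutD x y * ((V y + 1 : ℕ) : ℝ≥0∞) := by
            push_cast; ring
        _ ≤ _ := by gcongr
    · simp only [hy, if_false, add_zero]
      by_cases h0 : mutD x y = 0
      · simp [h0]
      · split_ifs with ha
        · have := hmono y h0 ha
          gcongr
        · exact le_rfl
  rw [e1]
  calc _ ≤ ∑ y, mutD x y * (if acc y x then (V y : ℝ≥0∞) else V x) + mutD x w := by gcongr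
    _ ≤ _ := e2
    _ = (∑ y, mutD x y) * (V x : ℝ≥0∞) := by rw [Finset.sum_mul]
    _ ≤ 1 * (V x : ℝ≥0∞) := by gcongr
    _ = _ := one_mul _

lemma hit_bound (K m : ℕ)
    (P : (Fin K → Fin m → Bool) → (Fin K → Fin m → Bool) → ℝ≥0∞)
    (A : (Fin K → Fin m → Bool) → Prop) (x₀ : Fin K → Fin m → Bool)
    (V : (Fin K → Fin m → Bool) → ℝ≥0∞) (ε : ℝ≥0∞)
    (hd : ∀ x, ¬ A x → ∑ y, P x y * V y + ε ≤ V x) :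
    expHitTime K m P A x₀ * ε ≤ V x₀ := by
  classical
  have hA : ∀ t y, A y → hitVec K m P A x₀ t y = 0 := by
    intro t y hy
    cases t with
    | zero => simp [hitVec, hy]
    | succ t => simp [hitVec, hy]
  have step : ∀ t, ∑ y, hitVec K m P A x₀ (t + 1) y * V y + (∑ y, hitVec K m P A x₀ t y) * ε
      ≤ ∑ y, hitVec K m P A x₀ t y * V y := by
    intro t
    calc _ ≤ ∑ y, (∑ x, hitVec K m P A x₀ t x * P x y) * V y + (∑ y, hitVec K m P A x₀ t y) * ε := by
          gcongr with y _
          simp only [hitVec]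
          split_ifs
          · exact zero_le
          · exact le_rfl
      _ = ∑ x, hitVec K m P A x₀ t x * (∑ y, P x y * V y + ε) := by
          simp only [Finset.sum_mul, mul_add, Finset.sum_add_distrib, Finset.mul_sum]
          rw [Finset.sum_comm]
          simp only [mul_assoc]
      _ ≤ _ := by
          refine Finset.sum_le_sum (fun x _ => ?_)
          by_cases h : A x
          · simp [hA t x h]
          · exact mul_le_mul_right (hd x h) _
  have tot : ∀ T, (∑ t ∈ Finset.range T, ∑ y, hitVec K m P A x₀ t y) * ε
      + ∑ y, hitVec K m P A x₀ T y * V y ≤ V x₀ := by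
    intro T
    induction T with
    | zero =>
      simp only [Finset.range_zero, Finset.sum_empty, zero_mul, zero_add, hitVec]
      rw [Finset.sum_eq_single x₀]
      · split_ifs <;> simp
      · intro b _ hb; simp [hb]
      · simp
    | succ T ih =>
      rw [Finset.sum_range_succ, add_mul, add_assoc]
      refine le_trans ?_ ih
      gcongr
      rw [add_comm]
      exact step T
  unfold expHitTime
  rw [← ENNReal.tsum_mul_right]
  refine ENNReal.tsum_le_of_sum_range_le (fun T => ?_)
  rw [← Finset.sum_mul]
  exact le_trans le_self_add (tot T)

end markov
end helpers

/-- RLS on the uniform-profit instance: there is an absolute constant `C > 0` such that,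
for any group structure and parameters and from every initial solution, the expected
number of iterations until the current solution is, for the first time, a feasible
solution of maximal profit among all feasible solutions is at most `C·n³`. -/
theorem RLS_uniform_profit_optimization :
    ∃ C : ℝ, 0 < C ∧
      ∀ (K m : ℕ), 1 ≤ K → 1 ≤ m →
      ∀ (a d c B α : ℝ), 0 < a → 0 < d → 0 < c → 0 < B → 0 < α → α < 1 →
      ∀ x₀ : Fin K → Fin m → Bool,
        expHitTime K m
            (stepP K m (mutRLS K m) (fge K m a d c B α (fun _ _ => 1)))
            (fun y => feasible K m a d c B α y ∧
              ∀ z, feasible K m a d c B α z → numOnes K m z ≤ numOnes K m y) x₀ ≤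
          ENNReal.ofReal (C * (K * m : ℝ) ^ 3) := by
  refine ⟨14, by norm_num, ?_⟩
  intro K m hK hm a d c B α ha hd hc hB hα0 hα x₀
  have hb := hit_bound K m (stepP K m (mutRLS K m) (fge K m a d c B α (fun _ _ => 1)))
    (fun y => feasible K m a d c B α y ∧
      ∀ z, feasible K m a d c B α z → numOnes K m z ≤ numOnes K m y) x₀
    (fun x => (VV K m a d c B α x : ℝ≥0∞)) (2 * ((K * m : ℕ) : ℝ≥0∞) ^ 2)⁻¹ (by
      intro x hx
      obtain ⟨w, w1, w2, w3⟩ := improve K m a d c B α hK ha hd hc hB hα0 hα x hx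
      refine drift K m _ _ (VV K m a d c B α) x w _ (mut_sum_le K m hK hm x) ?_ w2 w3
        (mut_ge K m hK hm x w w1)
      intro y hy hacc
      refine VV_mono K m a d c B α ha hd hc hα x y ?_ hacc
      by_contra! h
      apply hy
      unfold mutRLS
      rw [if_neg (by omega), if_neg (by omega)])
  have hn : 1 ≤ K * m := Nat.mul_pos hK hm
  have hn0 : (2 * ((K * m : ℕ) : ℝ≥0∞) ^ 2) ≠ 0 := by
    have : ((K * m : ℕ) : ℝ≥0∞) ≠ 0 := by
      rw [Nat.cast_ne_zero]; omega
    positivity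
  have hnt : (2 * ((K * m : ℕ) : ℝ≥0∞) ^ 2) ≠ ⊤ :=
    ENNReal.mul_ne_top (by simp) (ENNReal.pow_ne_top (ENNReal.natCast_ne_top _))
  rw [← div_eq_mul_inv, ENNReal.div_le_iff hn0 hnt] at hb
  refine hb.trans ?_
  have hV := VV_le K m hK hm a d c B α x₀
  have hfin : VV K m a d c B α x₀ * (2 * (K * m) ^ 2) ≤ 14 * (K * m) ^ 3 := by
    calc _ ≤ 7 * (K * m) * (2 * (K * m) ^ 2) := Nat.mul_le_mul_right _ hV
      _ = _ := by ring
  have e : ENNReal.ofReal (14 * ((K : ℝ) * m) ^ 3) = ((14 * (K * m) ^ 3 : ℕ) : ℝ≥0∞) := by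
    rw [← ENNReal.ofReal_natCast]; push_cast; rfl
  rw [e]
  exact_mod_cast hfin
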